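/- arXiv:1409.6382 — 2 statements merged into one kernel-verified Lean document; each statement's English description precedes it below -/
import Mathlib

section
/- In the group Iso(A^n) of Hamming isometries of A^n under composition, Conf(A^n) is a normal subgroup, Equ(A^n) is a subgroup with Conf(A^n) ∩ Equ(A^n) = {id}, and every element of Iso(A^n) is a product f ∘ σ̄ with f ∈ Conf(A^n) and σ̄ ∈ Equ(A^n); that is, Iso(A^n) is the internal semidirect product Conf(A^n) ⋊ Equ(A^n). -/
section HammingIsometry

open Function

variable {ι A β : Type*}

theorem eq_of_update_invariant [Finite ι] [DecidableEq ι] {f : (ι → A) → β} {x y : ι → A}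
    (h : ∀ j, x j ≠ y j → ∀ z b, f (update z j b) = f z) : f x = f y := by
  have := Fintype.ofFinite ι
  have key : ∀ s : Finset ι, f (s.piecewise y x) = f x := by
    intro s
    induction s using Finset.induction_on with
    | empty => simp
    | insert j s hj ih =>
      rw [Finset.piecewise_insert]
      by_cases hxy : x j = y j
      · rw [← hxy, show x j = s.piecewise y x j by simp [hj], update_eq_self, ih]
      · rw [h j hxy, ih]
  simpa using (key Finset.univ).symm

variable [Fintype ι] [DecidableEq A]

theorem hammingDist_le_one_of_agree_off {x y : ι → A} (i : ι)
    (h : ∀ k, k ≠ i → x k = y k) : hammingDist x y ≤ 1 := by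
  refine Finset.card_le_one.2 fun a ha b hb => ?_
  simp only [Finset.mem_filter, Finset.mem_univ, true_and] at ha hb
  rw [not_imp_comm.1 (h a) ha, not_imp_comm.1 (h b) hb]

theorem eq_of_hammingDist_le_one {x y : ι → A} (h : hammingDist x y ≤ 1) {i j : ι}
    (hi : x i ≠ y i) (hj : x j ≠ y j) : i = j :=
  Finset.card_le_one.1 h i (by simpa using hi) j (by simpa using hj)

variable [DecidableEq ι] {φ : (ι → A) → ι → A}

/-- A Hamming isometry maps every line through `x` into a line through `φ x`. -/
theorem exists_line_image [Nontrivial A]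
    (hφ : ∀ x y, hammingDist (φ x) (φ y) = hammingDist x y) (x : ι → A) (j : ι) :
    ∃ i, ∀ b k, k ≠ i → φ (update x j b) k = φ x k := by
  have hline : ∀ a b, hammingDist (φ (update x j a)) (φ (update x j b)) ≤ 1 := fun a b => by
    rw [hφ]
    exact hammingDist_le_one_of_agree_off j fun k hk => by simp [hk]
  have hline' : ∀ a, hammingDist (φ (update x j a)) (φ x) ≤ 1 := fun a => by
    simpa using hline a (x j)
  have hinj : Injective φ := fun u v huv => by
    rw [← hammingDist_eq_zero, ← hφ, huv, hammingDist_self]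
  obtain ⟨a, ha⟩ := exists_ne (x j)
  have hne : φ (update x j a) ≠ φ x := fun h => ha (by simpa using congrFun (hinj h) j)
  obtain ⟨i, hi⟩ := ne_iff.1 hne
  refine ⟨i, fun b k hk => ?_⟩
  by_contra hb
  have hak : φ (update x j a) k = φ x k := by
    by_contra h
    exact hk (eq_of_hammingDist_le_one (hline' a) h hi)
  have hbi : φ (update x j b) i = φ x i := by
    by_contra h
    exact hk (eq_of_hammingDist_le_one (hline' b) hb h)
  exact hk (eq_of_hammingDist_le_one (hline a b) (by rwa [hak, ne_comm]) (by rwa [hbi]))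

/-- Every Hamming isometry permutes the coordinates and then acts on each of them. -/
theorem exists_coordinate_form [Finite A]
    (hφ : ∀ x y, hammingDist (φ x) (φ y) = hammingDist x y) :
    ∃ (g : ι → Equiv.Perm A) (σ : Equiv.Perm ι), ∀ x i, φ x i = g i (x (σ i)) := by
  rcases subsingleton_or_nontrivial A with _ | _
  · exact ⟨1, 1, fun _ _ => Subsingleton.elim _ _⟩
  choose π hπ using exists_line_image hφ
  have hπ_inj : ∀ x, Injective (π x) := by
    intro x j k hjk
    by_contra hne
    obtain ⟨a, ha⟩ := exists_ne (x j)
    obtain ⟨b, hb⟩ := exists_ne (x k)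
    have hle : hammingDist (update x j a) (update x k b) ≤ 1 := by
      rw [← hφ]
      refine hammingDist_le_one_of_agree_off (π x j) fun l hl => ?_
      rw [hπ x j a l hl, hπ x k b l (hjk ▸ hl)]
    exact hne (eq_of_hammingDist_le_one hle (by simpa [hne] using ha)
      (by simpa [Ne.symm hne] using hb.symm))
  have hφ_inj : Injective φ := fun u v huv => by
    rw [← hammingDist_eq_zero, ← hφ, huv, hammingDist_self]
  have hπ_ne : ∀ x j b, b ≠ x j → φ (update x j b) (π x j) ≠ φ x (π x j) := by
    intro x j b hb h
    refine hb ?_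
    have : φ (update x j b) = φ x := funext fun k => by
      by_cases hk : k = π x j
      · rw [hk, h]
      · exact hπ x j b k hk
    simpa using congrFun (hφ_inj this) j
  have hπ_update : ∀ j k x b, π (update x k b) j = π x j := by
    intro j k x b
    by_cases hb : b = x k
    · rw [hb, update_eq_self]
    obtain ⟨c, hc⟩ := exists_ne (x j)
    by_contra hne
    by_cases hjk : j = k
    · subst hjk
      have h₁ := hπ (update x j b) j (x j) (π x j) (Ne.symm hne)
      rw [update_idem, update_eq_self] at h₁
      exact hπ_ne x j b hb h₁.symm
    have hc' : c ≠ update x k b j := by simpa [hjk] using hc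
    have hx' := hπ x k b
    have hx'_ne := hπ_ne x k b hb
    have hy := hπ x j c
    have hy_ne := hπ_ne x j c hc
    have hy' := hπ (update x k b) j c
    have hjk' : π x j ≠ π x k := fun h => hjk (hπ_inj x h)
    have hyy' : hammingDist (φ (update (update x k b) j c)) (φ (update x j c)) ≤ 1 := by
      rw [hφ]
      exact hammingDist_le_one_of_agree_off k fun l hl => by simp [update_apply, hl]
    have hr : π (update x k b) j = π x k := by
      by_contra hr
      refine hjk' (eq_of_hammingDist_le_one hyy' ?_ ?_)
      · rw [hy' _ (Ne.symm hne), hx' _ hjk']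
        exact hy_ne.symm
      · rw [hy' _ (Ne.symm hr), hy _ hjk'.symm]
        exact hx'_ne
    have hxy' : hammingDist (update (update x k b) j c) x ≤ 1 := by
      rw [← hφ]
      refine hammingDist_le_one_of_agree_off (π x k) fun l hl => ?_
      rw [hy' l (hr ▸ hl), hx' l hl]
    exact hjk (eq_of_hammingDist_le_one hxy' (by simpa using hc)
      (by simpa [Ne.symm hjk] using hb))
  obtain ⟨o⟩ : Nonempty (ι → A) := inferInstance
  have hπ_const : ∀ x, π x = π o := fun x => funext fun j =>
    eq_of_update_invariant (f := fun z => π z j) fun k _ z b => hπ_update j k z b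
  let τ : Equiv.Perm ι := Equiv.ofBijective (π o) (Finite.injective_iff_bijective.1 (hπ_inj o))
  have hg_inj : ∀ i, Injective fun a => φ (update o (τ.symm i) a) i := by
    intro i a b hab
    by_contra hne
    refine hπ_ne (update o (τ.symm i) b) (τ.symm i) a (by simpa using hne) ?_
    rw [hπ_const, show π o (τ.symm i) = i from τ.apply_symm_apply i, update_idem]
    exact hab
  refine ⟨fun i => Equiv.ofBijective _ (Finite.injective_iff_bijective.1 (hg_inj i)), τ.symm,
    fun x i => ?_⟩
  refine eq_of_update_invariant (f := fun z => φ z i) fun j hj z b => hπ z j b i ?_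
  rintro rfl
  rw [hπ_const, show τ.symm (π o j) = j from τ.symm_apply_apply j] at hj
  simp at hj

end HammingIsometry

theorem perm_apply_inv_self {α : Type*} (e : Equiv.Perm α) (a : α) : e (e⁻¹ a) = a :=
  e.apply_symm_apply a


/-- The isometries of `A^n` form a group `Iso(A^n)` (of permutations of
`A^n`), the configurations form a normal subgroup `Conf(A^n)`, the equivalences form a
subgroup `Equ(A^n)` with `Conf ∩ Equ = {id}`, and every isometry factors as `f ∘ σ̄`;
that is, `Iso(A^n) = Conf(A^n) ⋊ Equ(A^n)` as an internal semidirect product. -/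
theorem iso_eq_conf_semidirect_equ (A : Type*) [Fintype A] [DecidableEq A] [Nonempty A]
    (n : ℕ) :
    ∃ Iso Conf Equ : Subgroup (Equiv.Perm (Fin n → A)),
      ((Iso : Set (Equiv.Perm (Fin n → A))) =
        {φ | ∀ x y : Fin n → A, hammingDist (φ x) (φ y) = hammingDist x y}) ∧
      ((Conf : Set (Equiv.Perm (Fin n → A))) =
        {φ | ∃ g : Fin n → Equiv.Perm A, ∀ (x : Fin n → A) (i : Fin n), φ x i = g i (x i)}) ∧
      ((Equ : Set (Equiv.Perm (Fin n → A))) =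
        {φ | ∃ σ : Equiv.Perm (Fin n), ∀ (x : Fin n → A) (i : Fin n), φ x i = x (σ i)}) ∧
      Conf ≤ Iso ∧
      Equ ≤ Iso ∧
      (∀ φ ∈ Iso, ∀ f ∈ Conf, φ * f * φ⁻¹ ∈ Conf) ∧
      Conf ⊓ Equ = ⊥ ∧
      (∀ φ ∈ Iso, ∃ f ∈ Conf, ∃ e ∈ Equ, φ = f * e) := by
  let Iso : Subgroup (Equiv.Perm (Fin n → A)) :=
    { carrier := {φ | ∀ x y : Fin n → A, hammingDist (φ x) (φ y) = hammingDist x y}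
      mul_mem' := fun {φ ψ} hφ hψ x y => (hφ _ _).trans (hψ x y)
      one_mem' := fun _ _ => rfl
      inv_mem' := fun {φ} hφ x y => by
        simpa using (hφ (φ⁻¹ x) (φ⁻¹ y)).symm }
  let Conf : Subgroup (Equiv.Perm (Fin n → A)) :=
    { carrier :=
        {φ | ∃ g : Fin n → Equiv.Perm A, ∀ (x : Fin n → A) (i : Fin n), φ x i = g i (x i)}
      mul_mem' := by
        rintro φ ψ ⟨g, hg⟩ ⟨h, hh⟩
        exact ⟨g * h, fun x i => by simp [hg, hh]⟩
      one_mem' := ⟨1, fun _ _ => rfl⟩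
      inv_mem' := by
        rintro φ ⟨g, hg⟩
        refine ⟨g⁻¹, fun x i => ?_⟩
        rw [Pi.inv_apply, Equiv.Perm.eq_inv_iff_eq, ← hg, perm_apply_inv_self] }
  let Equ : Subgroup (Equiv.Perm (Fin n → A)) :=
    { carrier :=
        {φ | ∃ σ : Equiv.Perm (Fin n), ∀ (x : Fin n → A) (i : Fin n), φ x i = x (σ i)}
      mul_mem' := by
        rintro φ ψ ⟨σ, hσ⟩ ⟨τ, hτ⟩
        exact ⟨τ * σ, fun x i => by simp [hσ, hτ]⟩
      one_mem' := ⟨1, fun _ _ => rfl⟩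
      inv_mem' := by
        rintro φ ⟨σ, hσ⟩
        refine ⟨σ⁻¹, fun x i => ?_⟩
        have := hσ (φ⁻¹ x) (σ⁻¹ i)
        rw [perm_apply_inv_self, perm_apply_inv_self] at this
        exact this.symm }
  have factor : ∀ φ ∈ Iso, ∃ f ∈ Conf, ∃ e ∈ Equ, φ = f * e := by
    intro φ hφ
    obtain ⟨g, σ, h⟩ := exists_coordinate_form hφ
    refine ⟨Equiv.piCongrRight g, ⟨g, fun _ _ => rfl⟩, Equiv.arrowCongr σ.symm (Equiv.refl A),
      ⟨σ, fun _ _ => rfl⟩, ?_⟩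
    ext x i
    exact h x i
  refine ⟨Iso, Conf, Equ, rfl, rfl, rfl, ?_, ?_, ?_, ?_, factor⟩
  · rintro φ ⟨g, hg⟩ x y
    simp [hammingDist, hg]
  · rintro φ ⟨σ, hσ⟩ x y
    simp only [hammingDist, hσ]
    exact Finset.card_equiv σ (by simp)
  · intro φ hφ f hf
    obtain ⟨f', hf', e, he, rfl⟩ := factor φ hφ
    have hconj : e * f * e⁻¹ ∈ Conf := by
      obtain ⟨g, hg⟩ := hf
      obtain ⟨σ, hσ⟩ := he
      refine ⟨fun i => g (σ i), fun x i => ?_⟩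
      have := hσ (e⁻¹ x) i
      rw [perm_apply_inv_self] at this
      rw [Equiv.Perm.mul_apply, Equiv.Perm.mul_apply, hσ, hg, this]
    have := Conf.mul_mem (Conf.mul_mem hf' hconj) (Conf.inv_mem hf')
    simpa [mul_assoc] using this
  · rw [eq_bot_iff]
    rintro φ ⟨⟨g, hg⟩, σ, hσ⟩
    rw [Subgroup.mem_bot]
    ext x i
    calc φ x i = g i (x i) := hg x i
      _ = φ (fun _ => x i) i := (hg (fun _ => x i) i).symm
      _ = x i := hσ _ i
end

section
/- Let D_1,…,D_k be indecomposable group codes over G that are pairwise non-isomorphic as group codes, and let α_1,…,α_k ≥ 1. Then Aut_GC(D_1^{α_1} ⊕ ⋯ ⊕ D_k^{α_k}) is isomorphic as a group to the direct product over j = 1,…,k of the semidirect products (Aut_GC(D_j))^{α_j} ⋊ S_{α_j}, where S_{α_j} acts on (Aut_GC(D_j))^{α_j} by permuting the coordinates. -/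
section GroupCodes
variable {G : Type*} [Group G] [DecidableEq G]

/-- The canonical splitting homomorphism `G^{n+m} → G^n × G^m`. -/
def splitHom (G : Type*) [Group G] (n m : ℕ) :
    (Fin (n + m) → G) →* (Fin n → G) × (Fin m → G) where
  toFun z := (fun i => z (Fin.castAdd m i), fun j => z (Fin.natAdd n j))
  map_one' := rfl
  map_mul' _ _ := rfl

/-- Direct sum of two group codes, as a subgroup of `G^{n+m}`. -/
def gcSum {n m : ℕ} (C : Subgroup (Fin n → G)) (D : Subgroup (Fin m → G)) :
    Subgroup (Fin (n + m) → G) :=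
  (C.prod D).comap (splitHom G n m)

/-- `φ` is a morphism of group codes from `C` to `D`. -/
def IsGroupCodeHom {n m : ℕ} (C : Subgroup (Fin n → G)) (D : Subgroup (Fin m → G))
    (φ : (Fin n → G) → (Fin m → G)) : Prop :=
  (∀ x y : Fin n → G, φ (x * y) = φ x * φ y) ∧ (∀ x ∈ C, φ x ∈ D) ∧
    ∀ x y : Fin n → G, hammingDist (φ x) (φ y) ≤ hammingDist x y

/-- The group codes `C` and `D` are isomorphic as group codes. -/
def GroupCodeIso {n m : ℕ} (C : Subgroup (Fin n → G)) (D : Subgroup (Fin m → G)) : Prop :=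
  ∃ (φ : (Fin n → G) → (Fin m → G)) (ψ : (Fin m → G) → (Fin n → G)),
    IsGroupCodeHom C D φ ∧ IsGroupCodeHom D C ψ ∧
      Function.LeftInverse ψ φ ∧ Function.RightInverse ψ φ

/-- A group code is decomposable if it is isomorphic, as a group code, to a direct sum
of two group codes of positive lengths. -/
def GCDecomposable {n : ℕ} (C : Subgroup (Fin n → G)) : Prop :=
  ∃ (p q : ℕ) (D : Subgroup (Fin p → G)) (E : Subgroup (Fin q → G)),
    0 < p ∧ 0 < q ∧ GroupCodeIso C (gcSum D E)

/-- Reindexing homomorphism along an equality of lengths. -/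
def reindexHom (G : Type*) [Group G] {a b : ℕ} (h : a = b) :
    (Fin b → G) →* (Fin a → G) where
  toFun z := fun i => z (Fin.cast h i)
  map_one' := rfl
  map_mul' _ _ := rfl

/-- Direct sum of a finite family of group codes (of possibly different lengths). -/
def gcMultiSum : {k : ℕ} → {len : Fin k → ℕ} →
    (∀ i, Subgroup (Fin (len i) → G)) → Subgroup (Fin (∑ i, len i) → G)
  | 0, _, _ => ⊤
  | k + 1, len, D =>
    (gcSum (D 0) (gcMultiSum (fun i => D i.succ))).comap
      (reindexHom G (a := len 0 + ∑ i : Fin k, len i.succ) (b := ∑ i, len i)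
        (Fin.sum_univ_succ len).symm)

/-- Direct sum of `α` copies of the group code `D`. -/
def gcPow {m : ℕ} (D : Subgroup (Fin m → G)) (α : ℕ) :
    Subgroup (Fin (∑ _ : Fin α, m) → G) :=
  gcMultiSum (fun _ : Fin α => D)

/-- The group of group-code automorphisms of a group code `C ⊆ G^n`:  group automorphisms
of `G^n` that preserve the Hamming distance and map `C` onto `C`. -/
def AutGC {n : ℕ} (C : Subgroup (Fin n → G)) : Subgroup (MulAut (Fin n → G)) where
  carrier := {φ | (∀ x y, hammingDist (φ x) (φ y) = hammingDist x y) ∧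
    ∀ x, φ x ∈ C ↔ x ∈ C}
  one_mem' := ⟨fun _ _ => rfl, fun _ => Iff.rfl⟩
  mul_mem' := by
    rintro φ ψ ⟨hφ1, hφ2⟩ ⟨hψ1, hψ2⟩
    exact ⟨fun x y => (hφ1 (ψ x) (ψ y)).trans (hψ1 x y),
      fun x => (hφ2 (ψ x)).trans (hψ2 x)⟩
  inv_mem' := by
    rintro φ ⟨h1, h2⟩
    refine ⟨fun x y => ?_, fun x => ?_⟩
    · have := h1 (φ⁻¹ x) (φ⁻¹ y)
      rw [MulAut.apply_inv_self, MulAut.apply_inv_self] at this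
      exact this.symm
    · have := h2 (φ⁻¹ x)
      rw [MulAut.apply_inv_self] at this
      exact this.symm

/-- The action of `S_α` on `M^α` by permutation of coordinates, as a homomorphism
into the automorphism group. -/
def permActionHom (M : Type*) [Monoid M] (α : ℕ) :
    Equiv.Perm (Fin α) →* MulAut (Fin α → M) where
  toFun σ :=
    { toFun := fun f i => f (σ⁻¹ i)
      invFun := fun f i => f (σ i)
      left_inv := fun f => by funext i; simp
      right_inv := fun f => by funext i; simp
      map_mul' := fun _ _ => rfl }
  map_one' := by ext f i; simp
  map_mul' σ τ := by ext f i; simp [mul_inv_rev]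

/-- A cyclic group code: closed under the cyclic shift of coordinates. -/
def IsCyclicGC {n : ℕ} (C : Subgroup (Fin n → G)) : Prop :=
  ∀ x ∈ C, (x ∘ finRotate n) ∈ C

end GroupCodes

section BlockStructure

variable {G : Type*} [Group G] [DecidableEq G]

theorem hammingDist_map_one {K L : Type*} [Fintype K] [Fintype L] (φ : (K → G) →* (L → G))
    (hφ : ∀ x y, hammingDist (φ x) (φ y) = hammingDist x y) (x : K → G) :
    hammingDist (φ x) 1 = hammingDist x 1 := by
  rw [← hφ x 1, map_one]

theorem hammingDist_mulSingle_one {K : Type*} [Fintype K] [DecidableEq K] (k : K) {g : G}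
    (hg : g ≠ 1) : hammingDist (Pi.mulSingle k g : K → G) 1 = 1 := by
  rw [hammingDist, Finset.card_eq_one]
  refine ⟨k, ?_⟩
  ext i
  by_cases h : i = k
  · subst h; simpa using hg
  · simp [h]

theorem eq_mulSingle_of_hammingDist_one {K : Type*} [Fintype K] [DecidableEq K] {x : K → G}
    (hx : hammingDist x 1 = 1) : ∃ k g, g ≠ 1 ∧ x = Pi.mulSingle k g := by
  rw [hammingDist, Finset.card_eq_one] at hx
  obtain ⟨k, hk⟩ := hx
  have h : ∀ i, x i ≠ 1 ↔ i = k := fun i => by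
    simpa using Finset.ext_iff.1 hk i
  refine ⟨k, x k, (h k).2 rfl, funext fun i => ?_⟩
  by_cases hi : i = k
  · subst hi; simp
  · rw [Pi.mulSingle_eq_of_ne hi]
    by_contra hne
    exact hi ((h i).1 hne)

theorem hammingDist_mulSingle_of_ne {K : Type*} [Fintype K] [DecidableEq K] {k l : K}
    (hkl : k ≠ l) {g h : G} (hg : g ≠ 1) (hh : h ≠ 1) :
    hammingDist (Pi.mulSingle k g : K → G) (Pi.mulSingle l h) = 2 := by
  rw [hammingDist, Finset.card_eq_two]
  refine ⟨k, l, hkl, ?_⟩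
  ext i
  by_cases hk : i = k
  · subst hk; simp [hkl, hg]
  · by_cases hl : i = l
    · subst hl; simpa [hk] using hh.symm
    · simp [hk, hl]

theorem hammingDist_mulSingle_le_one {K : Type*} [Fintype K] [DecidableEq K] (k : K) (g h : G) :
    hammingDist (Pi.mulSingle k g : K → G) (Pi.mulSingle k h) ≤ 1 := by
  rw [hammingDist]
  refine (Finset.card_le_card (t := {k}) fun i hi => ?_).trans (Finset.card_singleton k).le
  by_contra hne
  simp only [Finset.mem_singleton] at hne
  simp [hne] at hi

/-- Distance-preserving endomorphisms of `G^K` are monomial: they permute the coordinates up to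
maps acting coordinatewise. -/
theorem exists_perm_of_isometry {K : Type*} [Fintype K] [Nontrivial G]
    (φ : (K → G) →* (K → G))
    (hφ : ∀ x y, hammingDist (φ x) (φ y) = hammingDist x y) :
    ∃ π : Equiv.Perm K, ∀ x y k, φ x (π k) = φ y (π k) ↔ x k = y k := by
  classical
  obtain ⟨g, hg⟩ := exists_ne (1 : G)
  have hsingle : ∀ k (h : G), h ≠ 1 → ∃ l h', h' ≠ 1 ∧ φ (Pi.mulSingle k h) = Pi.mulSingle l h' :=
    fun k h hh => eq_mulSingle_of_hammingDist_one <| by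
      rw [hammingDist_map_one φ hφ, hammingDist_mulSingle_one k hh]
  choose π g' hg' hπ using fun k => hsingle k g hg
  have hπ' : ∀ k (h : G), ∃ h', φ (Pi.mulSingle k h) = Pi.mulSingle (π k) h' := by
    intro k h
    by_cases hh : h = 1
    · exact ⟨1, by simp [hh]⟩
    · obtain ⟨l, h', hh', e⟩ := hsingle k h hh
      by_cases hl : l = π k
      · exact ⟨h', by rw [e, hl]⟩
      · have h1 := hφ (Pi.mulSingle k h) (Pi.mulSingle k g)
        rw [e, hπ, hammingDist_mulSingle_of_ne hl hh' (hg' k)] at h1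
        have := hammingDist_mulSingle_le_one k h g
        omega
  have hinj : Function.Injective π := by
    intro k l hkl
    by_contra hne
    have h1 := hφ (Pi.mulSingle k g) (Pi.mulSingle l g)
    rw [hammingDist_mulSingle_of_ne hne hg hg, hπ, hπ, hkl] at h1
    have := hammingDist_mulSingle_le_one (π l) (g' k) (g' l)
    omega
  have hne : ∀ x k, x k ≠ 1 → φ x (π k) ≠ 1 := by
    intro x k hk h1
    obtain ⟨h', hh'⟩ := hπ' k (x k)⁻¹
    have hlt : hammingDist (x * Pi.mulSingle k (x k)⁻¹) 1 < hammingDist x 1 := by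
      refine Finset.card_lt_card (Finset.ssubset_iff_subset_ne.2 ⟨fun i hi => ?_, fun he => ?_⟩)
      · by_cases hik : i = k
        · subst hik; simpa using hk
        · simpa [hik] using hi
      · have := Finset.ext_iff.1 he k
        simp [hk] at this
    have hle : hammingDist (φ x) 1 ≤ hammingDist (φ x * Pi.mulSingle (π k) h') 1 := by
      refine Finset.card_le_card fun i hi => ?_
      by_cases hik : i = π k
      · subst hik; simp [h1] at hi
      · simpa [hik] using hi
    rw [← hh', ← map_mul, hammingDist_map_one φ hφ, hammingDist_map_one φ hφ] at hle
    omega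
  refine ⟨Equiv.ofBijective π (Finite.injective_iff_bijective.1 hinj), fun x y k => ?_⟩
  have key : ∀ x k, φ x (π k) = 1 ↔ x k = 1 := by
    intro x k
    refine ⟨fun h => by_contra fun hk => hne x k hk h, fun h => ?_⟩
    have hsub : (Finset.univ.filter fun i => x i ≠ (1 : K → G) i).map ⟨π, hinj⟩ ⊆
        Finset.univ.filter fun i => φ x i ≠ (1 : K → G) i := by
      intro i hi
      obtain ⟨k, hk, rfl⟩ := Finset.mem_map.1 hi
      simpa using hne x k (by simpa using hk)
    have heq := Finset.eq_of_subset_of_card_le hsub (by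
      rw [Finset.card_map]; exact (hammingDist_map_one φ hφ x).le)
    by_contra hk
    have hmem : π k ∈ Finset.univ.filter fun i => φ x i ≠ (1 : K → G) i := by simpa using hk
    rw [← heq] at hmem
    obtain ⟨k', hk', he⟩ := Finset.mem_map.1 hmem
    obtain rfl : k' = k := hinj he
    simp [h] at hk'
  have := key (x / y) k
  simpa [map_div, div_eq_one] using this

/-- A code that is closed under restriction to a proper nonempty set of coordinates is
decomposable. -/
theorem gcDecomposable_of_mulIndicator_mem {n : ℕ} (D : Subgroup (Fin n → G)) (S : Set (Fin n))
    (hS : S.Nonempty) (hSc : Sᶜ.Nonempty) (h : ∀ x ∈ D, S.mulIndicator x ∈ D) :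
    GCDecomposable D := by
  classical
  let η : Fin (Fintype.card S + Fintype.card ↑Sᶜ) ≃ Fin n :=
    finSumFinEquiv.symm.trans (((Fintype.equivFin S).symm.sumCongr
      (Fintype.equivFin ↑Sᶜ).symm).trans (Equiv.Set.sumCompl S))
  have hη1 : ∀ i, η (Fin.castAdd _ i) ∈ S := fun i => by simp [η]
  have hη2 : ∀ i, η (Fin.natAdd _ i) ∉ S := fun i => by
    have := ((Fintype.equivFin ↑Sᶜ).symm i).2
    rw [Set.mem_compl_iff] at this
    simpa only [η, Equiv.trans_apply, finSumFinEquiv_symm_apply_natAdd, Equiv.sumCongr_apply,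
      Sum.map_inr, Equiv.Set.sumCompl_apply_inr] using this
  let r : (Fin n → G) →* (Fin (Fintype.card S + Fintype.card ↑Sᶜ) → G) :=
    { toFun := fun x i => x (η i), map_one' := rfl, map_mul' := fun _ _ => rfl }
  have hdist : ∀ x y : Fin n → G, hammingDist (r x) (r y) = hammingDist x y := fun x y =>
    Finset.card_bij (fun i _ => η i) (fun i hi => by simpa [r] using hi)
      (fun i _ j _ hij => η.injective hij)
      (fun k hk => ⟨η.symm k, by simpa [r] using hk, by simp⟩)
  let s : (Fin (Fintype.card S + Fintype.card ↑Sᶜ) → G) → (Fin n → G) := fun z i => z (η.symm i)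
  have hrs : ∀ z, r (s z) = z := fun z => funext fun i => by simp [r, s]
  have hsr : ∀ x, s (r x) = x := fun x => funext fun i => by simp [r, s]
  refine ⟨_, _, D.map ((MonoidHom.fst _ _).comp ((splitHom G _ _).comp r)),
    D.map ((MonoidHom.snd _ _).comp ((splitHom G _ _).comp r)),
    Fintype.card_pos_iff.2 hS.to_subtype, Fintype.card_pos_iff.2 hSc.to_subtype,
    r, s, ⟨map_mul r, fun x hx => ⟨⟨x, hx, rfl⟩, ⟨x, hx, rfl⟩⟩, fun x y => (hdist x y).le⟩,
    ⟨fun _ _ => rfl, ?_, fun x y => ?_⟩, hsr, hrs⟩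
  · rintro z ⟨⟨x, hx, hxz⟩, ⟨y, hy, hyz⟩⟩
    have hz : s z = S.mulIndicator x * ((S.mulIndicator y)⁻¹ * y) := by
      refine (congrArg s (funext fun i => ?_)).trans (hsr _)
      refine Fin.addCases (fun i => ?_) (fun i => ?_) i
      · have := congrFun hxz i
        simp [splitHom, r] at this
        simp [r, hη1, this]
      · have := congrFun hyz i
        simp [splitHom, r] at this
        simp [r, hη2, this]
    rw [hz]
    exact D.mul_mem (h x hx) (D.mul_mem (D.inv_mem (h y hy)) hy)
  · rw [← hdist, hrs, hrs]

/-- Cutting a word into blocks. -/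
def blockEquiv (G : Type*) [Group G] {I K : Type*} {m : I → ℕ} (e : (Σ p, Fin (m p)) ≃ K) :
    (K → G) ≃* (∀ p, Fin (m p) → G) where
  toFun x p i := x (e ⟨p, i⟩)
  invFun w k := w (e.symm k).1 (e.symm k).2
  left_inv x := by ext k; simp
  right_inv w := by
    funext p i
    have : ∀ q : Σ p, Fin (m p), q = ⟨p, i⟩ → w q.1 q.2 = w p i := by rintro _ rfl; rfl
    exact this _ (e.symm_apply_apply _)
  map_mul' _ _ := rfl

theorem hammingDist_blockEquiv {I K : Type*} [Fintype I] [Fintype K] {m : I → ℕ}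
    (e : (Σ p, Fin (m p)) ≃ K) (x y : K → G) :
    hammingDist x y = ∑ p, hammingDist (blockEquiv G e x p) (blockEquiv G e y p) := by
  simp only [hammingDist, Finset.card_filter]
  rw [← Equiv.sum_comp e, Fintype.sum_sigma]
  rfl

theorem hammingDist_block_le {I K : Type*} [Fintype I] [Fintype K] {m : I → ℕ}
    (e : (Σ p, Fin (m p)) ≃ K) (x y : K → G) (p : I) :
    hammingDist (blockEquiv G e x p) (blockEquiv G e y p) ≤ hammingDist x y := by
  rw [hammingDist_blockEquiv e]
  exact Finset.single_le_sum
    (f := fun p => hammingDist (blockEquiv G e x p) (blockEquiv G e y p))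
    (fun _ _ => Nat.zero_le _) (Finset.mem_univ p)

theorem hammingDist_blockEquiv_symm_mulSingle {I K : Type*} [Fintype I] [DecidableEq I]
    [Fintype K] {m : I → ℕ} (e : (Σ p, Fin (m p)) ≃ K) (p : I) (y y' : Fin (m p) → G) :
    hammingDist ((blockEquiv G e).symm (Pi.mulSingle p y))
      ((blockEquiv G e).symm (Pi.mulSingle p y')) = hammingDist y y' := by
  rw [hammingDist_blockEquiv e, Finset.sum_eq_single p]
  · simp
  · intro q _ hq
    simp [hq]
  · simp

/-- If `φ` is a code automorphism such that the `q`-th block of `φ x` determines and is determined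
by the `p`-th block of `x`, then `φ` induces an isomorphism between these block codes. -/
theorem exists_blockMap {I : Type*} [Fintype I] {m : I → ℕ} {N : ℕ}
    (e : (Σ p, Fin (m p)) ≃ Fin N) (D : ∀ p, Subgroup (Fin (m p) → G)) (C : Subgroup (Fin N → G))
    (hC : ∀ x, x ∈ C ↔ ∀ p, blockEquiv G e x p ∈ D p) {φ : MulAut (Fin N → G)} (hφ : φ ∈ AutGC C)
    {p q : I} (h : ∀ x y, blockEquiv G e (φ x) q = blockEquiv G e (φ y) q ↔
      blockEquiv G e x p = blockEquiv G e y p) :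
    ∃ f : (Fin (m p) → G) ≃* (Fin (m q) → G),
      (∀ x, blockEquiv G e (φ x) q = f (blockEquiv G e x p)) ∧
      (∀ y y', hammingDist (f y) (f y') = hammingDist y y') ∧ ∀ y, f y ∈ D q ↔ y ∈ D p := by
  classical
  obtain ⟨hd, hmem⟩ := hφ
  let ins : ∀ p, (Fin (m p) → G) →* (Fin N → G) := fun p =>
    (blockEquiv G e).symm.toMonoidHom.comp (MonoidHom.mulSingle (fun p => Fin (m p) → G) p)
  have hins : ∀ p y, blockEquiv G e (ins p y) p = y := fun p y => by simp [ins]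
  have hinsC : ∀ p, ∀ y ∈ D p, ins p y ∈ C := fun p y hy => (hC _).2 fun r => by
    by_cases hr : r = p
    · subst hr; simpa [ins] using hy
    · simp [ins, hr]
  let f₀ : (Fin (m p) → G) →* (Fin (m q) → G) :=
    { toFun := fun y => blockEquiv G e (φ (ins p y)) q
      map_one' := by simp
      map_mul' := fun y y' => by simp }
  have hf₀ : ∀ x, blockEquiv G e (φ x) q = f₀ (blockEquiv G e x p) := fun x =>
    (h _ _).2 (hins p _).symm
  have hbij : Function.Bijective f₀ := by
    refine ⟨fun y y' hy => ?_, fun z => ⟨blockEquiv G e (φ⁻¹ (ins q z)) p, ?_⟩⟩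
    · simpa [hins] using (h _ _).1 hy
    · rw [← hf₀, MulAut.apply_inv_self, hins]
  have hinv : ∀ y, blockEquiv G e (φ⁻¹ (ins q (f₀ y))) p = y := fun y => hbij.1 <| by
    rw [← hf₀, MulAut.apply_inv_self, hins]
  refine ⟨MulEquiv.ofBijective f₀ hbij, hf₀, fun y y' => le_antisymm ?_ ?_, fun y => ⟨?_, ?_⟩⟩
  · exact (hammingDist_block_le e _ _ q).trans
      ((hd _ _).trans (hammingDist_blockEquiv_symm_mulSingle e p y y')).le
  · have h1 := hammingDist_block_le e (φ⁻¹ (ins q (f₀ y))) (φ⁻¹ (ins q (f₀ y'))) p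
    rw [hinv, hinv, ← hd, MulAut.apply_inv_self, MulAut.apply_inv_self] at h1
    exact h1.trans (hammingDist_blockEquiv_symm_mulSingle e q _ _).le
  · intro hy
    have h1 := hinsC q _ hy
    rw [← MulAut.apply_inv_self _ φ (ins q _), hmem, hC] at h1
    have h2 := h1 p
    rwa [MulEquiv.ofBijective_apply, hinv] at h2
  · intro hy
    exact (hC _).1 ((hmem _).2 (hinsC p y hy)) q

theorem block_eq_of_indecomposable {I : Type*} {m : I → ℕ} {N : ℕ}
    (e : (Σ p, Fin (m p)) ≃ Fin N) (D : ∀ p, Subgroup (Fin (m p) → G)) (C : Subgroup (Fin N → G))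
    (hC : ∀ x, x ∈ C ↔ ∀ p, blockEquiv G e x p ∈ D p) (hind : ∀ p, ¬ GCDecomposable (D p))
    {φ : MulAut (Fin N → G)} (hφ : φ ∈ AutGC C) (π : Equiv.Perm (Fin N))
    (hπ : ∀ x y k, φ x (π k) = φ y (π k) ↔ x k = y k) {k l : Fin N}
    (hkl : (e.symm k).1 = (e.symm l).1) : (e.symm (π k)).1 = (e.symm (π l)).1 := by
  classical
  let S : Set (Fin N) := {i | (e.symm (π i)).1 = (e.symm (π l)).1}
  have hS : ∀ x ∈ C, S.mulIndicator x ∈ C := by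
    intro x hx
    rw [← hφ.2, hC]
    intro p
    by_cases hp : p = (e.symm (π l)).1
    · have : blockEquiv G e (φ (S.mulIndicator x)) p = blockEquiv G e (φ x) p := by
        funext i
        obtain ⟨j, hj⟩ := π.surjective (e ⟨p, i⟩)
        change φ _ (e ⟨p, i⟩) = φ _ (e ⟨p, i⟩)
        rw [← hj, hπ]
        refine Set.mulIndicator_of_mem ?_ _
        simp [S, hj, hp]
      rw [this]
      exact (hC _).1 ((hφ.2 x).2 hx) p
    · have : blockEquiv G e (φ (S.mulIndicator x)) p = 1 := by
        funext i
        obtain ⟨j, hj⟩ := π.surjective (e ⟨p, i⟩)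
        rw [← Pi.one_apply (M := fun q => Fin (m q) → G) p, ← map_one (blockEquiv G e),
          ← map_one φ]
        change φ _ (e ⟨p, i⟩) = φ _ (e ⟨p, i⟩)
        rw [← hj, hπ]
        refine Set.mulIndicator_of_notMem ?_ _
        simp [S, hj, hp]
      rw [this]
      exact (D p).one_mem
  obtain ⟨⟨p, i⟩, rfl⟩ := e.surjective k
  obtain ⟨⟨p', i'⟩, rfl⟩ := e.surjective l
  simp only [Equiv.symm_apply_apply] at hkl
  subst hkl
  by_contra hne
  refine hind p (gcDecomposable_of_mulIndicator_mem (D p) {j | e ⟨p, j⟩ ∈ S} ⟨i', rfl⟩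
    ⟨i, hne⟩ fun x hx => ?_)
  have h1 : (blockEquiv G e).symm (Pi.mulSingle p x) ∈ C := (hC _).2 fun r => by
    by_cases hr : r = p
    · subst hr; simpa using hx
    · simp [hr]
  convert (hC _).1 (hS _ h1) p using 1
  funext j
  have h2 : (blockEquiv G e).symm (Pi.mulSingle p x) (e ⟨p, j⟩) = x j := by
    change blockEquiv G e ((blockEquiv G e).symm (Pi.mulSingle p x)) p j = x j
    simp
  change _ = S.mulIndicator _ (e ⟨p, j⟩)
  simp only [Set.mulIndicator_apply, Set.mem_ofPred_eq, h2]

/-- An automorphism of a direct sum of indecomposable codes permutes the summands. -/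
theorem exists_blockPerm [Nontrivial G] {I : Type*} {m : I → ℕ} (hm : ∀ p, 0 < m p)
    {N : ℕ} (e : (Σ p, Fin (m p)) ≃ Fin N) (D : ∀ p, Subgroup (Fin (m p) → G))
    (C : Subgroup (Fin N → G)) (hC : ∀ x, x ∈ C ↔ ∀ p, blockEquiv G e x p ∈ D p)
    (hind : ∀ p, ¬ GCDecomposable (D p)) {φ : MulAut (Fin N → G)} (hφ : φ ∈ AutGC C) :
    ∃ τ : Equiv.Perm I, ∀ p x y, blockEquiv G e (φ x) (τ p) = blockEquiv G e (φ y) (τ p) ↔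
      blockEquiv G e x p = blockEquiv G e y p := by
  obtain ⟨π, hπ⟩ := exists_perm_of_isometry φ.toMonoidHom hφ.1
  replace hπ : ∀ x y k, φ x (π k) = φ y (π k) ↔ x k = y k := hπ
  have hπ' : ∀ x y k, φ⁻¹ x (π⁻¹ k) = φ⁻¹ y (π⁻¹ k) ↔ x k = y k := fun x y k => by
    have := hπ (φ⁻¹ x) (φ⁻¹ y) (π⁻¹ k)
    simpa using this.symm
  have h1 : ∀ {k l : Fin N}, (e.symm k).1 = (e.symm l).1 → (e.symm (π k)).1 = (e.symm (π l)).1 :=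
    block_eq_of_indecomposable e D C hC hind hφ π hπ
  have h2 : ∀ {k l : Fin N}, (e.symm k).1 = (e.symm l).1 →
      (e.symm (π⁻¹ k)).1 = (e.symm (π⁻¹ l)).1 :=
    block_eq_of_indecomposable e D C hC hind (inv_mem hφ) π⁻¹ hπ'
  let τ : Equiv.Perm I :=
    { toFun := fun p => (e.symm (π (e ⟨p, ⟨0, hm p⟩⟩))).1
      invFun := fun p => (e.symm (π⁻¹ (e ⟨p, ⟨0, hm p⟩⟩))).1
      left_inv := fun p => by
        refine (h2 (l := π (e ⟨p, ⟨0, hm p⟩⟩)) ?_).trans ?_ <;> simp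
      right_inv := fun p => by
        refine (h1 (l := π⁻¹ (e ⟨p, ⟨0, hm p⟩⟩)) ?_).trans ?_ <;> simp }
  have hτ : ∀ k, (e.symm (π k)).1 = τ (e.symm k).1 := fun k => h1 (by simp)
  refine ⟨τ, fun p x y => ⟨fun h => funext fun i => ?_, fun h => funext fun i => ?_⟩⟩
  · refine (hπ x y (e ⟨p, i⟩)).1 ?_
    have hb := hτ (e ⟨p, i⟩)
    obtain ⟨⟨q, j⟩, hq⟩ := e.surjective (π (e ⟨p, i⟩))
    rw [← hq] at hb ⊢
    simp only [Equiv.symm_apply_apply] at hb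
    subst hb
    exact congrFun h j
  · obtain ⟨k, hk⟩ := π.surjective (e ⟨τ p, i⟩)
    change φ x (e ⟨τ p, i⟩) = φ y (e ⟨τ p, i⟩)
    rw [← hk, hπ]
    have hb := hτ k
    rw [hk] at hb
    obtain ⟨⟨q, j⟩, rfl⟩ := e.surjective k
    simp only [Equiv.symm_apply_apply, EmbeddingLike.apply_eq_iff_eq] at hb
    subst hb
    exact congrFun h j

/-- The coordinates of a direct sum of codes are the pairs of a summand and a coordinate of it. -/
theorem exists_equiv_mem_gcMultiSum {G : Type*} [Group G] : ∀ {k : ℕ} {len : Fin k → ℕ}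
    (D : ∀ i, Subgroup (Fin (len i) → G)),
    ∃ e : (Σ i, Fin (len i)) ≃ Fin (∑ i, len i),
      ∀ x, x ∈ gcMultiSum D ↔ ∀ i, (fun a => x (e ⟨i, a⟩)) ∈ D i
  | 0, len, D => ⟨(Equiv.equivOfIsEmpty _ (Fin 0)).trans (finCongr (by simp)), fun x => by
      simp [gcMultiSum]⟩
  | k + 1, len, D => by
    obtain ⟨e, he⟩ := exists_equiv_mem_gcMultiSum fun i => D i.succ
    let c : (Σ i, Fin (len i)) ≃ Fin (len 0) ⊕ Σ i : Fin k, Fin (len i.succ) :=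
      { toFun := fun q => Fin.cases (motive := fun i => Fin (len i) → _) Sum.inl
          (fun i a => Sum.inr ⟨i, a⟩) q.1 q.2
        invFun := Sum.elim (fun a => ⟨0, a⟩) fun q => ⟨q.1.succ, q.2⟩
        left_inv := by
          rintro ⟨i, a⟩
          induction i using Fin.cases <;> rfl
        right_inv := by rintro (a | ⟨i, a⟩) <;> rfl }
    refine ⟨c.trans (((Equiv.refl _).sumCongr e).trans (finSumFinEquiv.trans
      (finCongr (Fin.sum_univ_succ len).symm))), fun x => ?_⟩
    rw [Fin.forall_fin_succ]
    exact and_congr Iff.rfl (he _)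

end BlockStructure

section WreathAction

variable {G : Type*} [Group G] [DecidableEq G] {k : ℕ} {m α : Fin k → ℕ}
  {D : ∀ j, Subgroup (Fin (m j) → G)}

/-- The action of the product of the wreath products on words cut into blocks. -/
def wreathAct (D : ∀ j, Subgroup (Fin (m j) → G)) :
    (∀ j, (Fin (α j) → ↥(AutGC (D j))) ⋊[permActionHom ↥(AutGC (D j)) (α j)]
      Equiv.Perm (Fin (α j))) →*
    MulAut (∀ p : Σ j, Fin (α j), Fin (m p.1) → G) where
  toFun γ :=
    { toFun := fun w p =>
        ((γ p.1).left p.2 : MulAut (Fin (m p.1) → G)) (w ⟨p.1, (γ p.1).right⁻¹ p.2⟩)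
      invFun := fun w p =>
        ((γ p.1).left ((γ p.1).right p.2) : MulAut (Fin (m p.1) → G))⁻¹
          (w ⟨p.1, (γ p.1).right p.2⟩)
      left_inv := fun w => funext fun ⟨j, a⟩ => by
        refine (MulAut.inv_apply_self _ _ _).trans ?_
        have h := (γ j).right.symm_apply_apply a
        exact congrArg (β := Fin (m j) → G) (fun b => w ⟨j, b⟩) h
      right_inv := fun w => funext fun ⟨j, a⟩ => by
        refine Eq.trans ?_ (MulAut.apply_inv_self _ ((γ j).left a : MulAut (Fin (m j) → G)) _)
        have h := (γ j).right.apply_symm_apply a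
        exact congrArg (fun b => ((γ j).left a : MulAut (Fin (m j) → G))
          (((γ j).left b : MulAut (Fin (m j) → G))⁻¹ (w ⟨j, b⟩))) h
      map_mul' := fun w w' => by funext p; simp }
  map_one' := MulEquiv.ext fun _ => rfl
  map_mul' _ _ := MulEquiv.ext fun _ => rfl

theorem wreathAct_apply (γ : ∀ j, (Fin (α j) → ↥(AutGC (D j)))
      ⋊[permActionHom ↥(AutGC (D j)) (α j)] Equiv.Perm (Fin (α j)))
    (w : ∀ p : Σ j, Fin (α j), Fin (m p.1) → G) (j : Fin k) (a : Fin (α j)) :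
    wreathAct D γ w ⟨j, a⟩ =
      ((γ j).left a : MulAut (Fin (m j) → G)) (w ⟨j, (γ j).right⁻¹ a⟩) := rfl

theorem wreathAct_injective [Nontrivial G] (hm : ∀ j, 0 < m j) :
    Function.Injective (wreathAct (α := α) D) := by
  classical
  rw [injective_iff_map_eq_one]
  intro γ hγ
  have h : ∀ (w : ∀ p : Σ j, Fin (α j), Fin (m p.1) → G) j a, ((γ j).left a : MulAut (Fin (m j) → G)) (w ⟨j, (γ j).right⁻¹ a⟩) = w ⟨j, a⟩ :=
    fun w j a => by rw [← wreathAct_apply, hγ, MulAut.one_apply]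
  have hr : ∀ j, (γ j).right⁻¹ = 1 := fun j => Equiv.ext fun a => by
    have : Nonempty (Fin (m j)) := ⟨⟨0, hm j⟩⟩
    obtain ⟨y, hy⟩ := exists_ne (1 : Fin (m j) → G)
    by_contra hne
    rw [Equiv.Perm.one_apply] at hne
    have hw := h (Pi.mulSingle (⟨j, a⟩ : Σ j, Fin (α j)) y) j a
    rw [Pi.mulSingle_eq_same, Pi.mulSingle_eq_of_ne (by simpa using hne), map_one] at hw
    exact hy hw.symm
  funext j
  refine SemidirectProduct.ext (funext fun a => Subtype.ext (MulEquiv.ext fun y => ?_))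
    (inv_eq_one.1 (hr j))
  have hw := h (Pi.mulSingle (⟨j, a⟩ : Σ j, Fin (α j)) y) j a
  rw [hr, Equiv.Perm.one_apply, Pi.mulSingle_eq_same] at hw
  simpa using hw

theorem symm_wreathAct_mem_autGC {N : ℕ} (e : (Σ p : (Σ j, Fin (α j)), Fin (m p.1)) ≃ Fin N)
    (C : Subgroup (Fin N → G))
    (hC : ∀ x, x ∈ C ↔ ∀ p : Σ j, Fin (α j), blockEquiv G e x p ∈ D p.1)
    (γ : ∀ j, (Fin (α j) → ↥(AutGC (D j)))
      ⋊[permActionHom ↥(AutGC (D j)) (α j)] Equiv.Perm (Fin (α j))) :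
    MulAut.congr (blockEquiv G e).symm (wreathAct D γ) ∈ AutGC C := by
  have hE : ∀ x, blockEquiv G e (MulAut.congr (blockEquiv G e).symm (wreathAct D γ) x) =
      wreathAct D γ (blockEquiv G e x) := fun x => by simp [MulAut.congr]
  refine ⟨fun x y => ?_, fun x => ?_⟩
  · rw [hammingDist_blockEquiv e, hammingDist_blockEquiv e x, hE, hE, Fintype.sum_sigma,
      Fintype.sum_sigma]
    refine Finset.sum_congr rfl fun j _ => ?_
    rw [← Equiv.sum_comp ((γ j).right⁻¹) fun a => hammingDist (blockEquiv G e x ⟨j, a⟩) _]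
    exact Finset.sum_congr rfl fun a _ => ((γ j).left a).2.1 _ _
  · rw [hC, hC, hE, Sigma.forall, Sigma.forall]
    refine forall_congr' fun j => ?_
    rw [← ((γ j).right⁻¹).forall_congr_right
      (q := fun a => blockEquiv G e x (⟨j, a⟩ : Σ j, Fin (α j)) ∈ D j)]
    exact forall_congr' fun a => ((γ j).left a).2.2 _

theorem exists_wreathAct_eq [Nontrivial G] (hm : ∀ j, 0 < m j) {N : ℕ}
    (e : (Σ p : (Σ j, Fin (α j)), Fin (m p.1)) ≃ Fin N) (C : Subgroup (Fin N → G))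
    (hC : ∀ x, x ∈ C ↔ ∀ p : Σ j, Fin (α j), blockEquiv G e x p ∈ D p.1)
    (hind : ∀ j, ¬ GCDecomposable (D j))
    (hnoniso : ∀ s t, s ≠ t → ¬ GroupCodeIso (D s) (D t))
    {φ : MulAut (Fin N → G)} (hφ : φ ∈ AutGC C) :
    ∃ γ : ∀ j, (Fin (α j) → ↥(AutGC (D j)))
      ⋊[permActionHom ↥(AutGC (D j)) (α j)] Equiv.Perm (Fin (α j)),
      MulAut.congr (blockEquiv G e).symm (wreathAct D γ) = φ := by
  obtain ⟨τ, hτ⟩ := exists_blockPerm (fun p : Σ j, Fin (α j) => hm p.1) e (fun p => D p.1) C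
    hC (fun p => hind p.1) hφ
  have hfst : ∀ p, p.1 = (τ p).1 := fun p => by
    by_contra hne
    obtain ⟨f, -, hf1, hf2⟩ := exists_blockMap e (fun p => D p.1) C hC hφ (hτ p)
    refine hnoniso _ _ hne ⟨f, f.symm, ⟨map_mul f, fun y hy => (hf2 y).2 hy,
      fun y y' => (hf1 y y').le⟩, ⟨map_mul f.symm, fun z hz => ?_, fun z z' => ?_⟩,
      f.left_inv, f.right_inv⟩
    · rw [← hf2]; simpa using hz
    · rw [← hf1]; simp
  have hto : ∀ j a, ∃ b, τ ⟨j, a⟩ = ⟨j, b⟩ := fun j a => by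
    have := hfst ⟨j, a⟩
    generalize τ ⟨j, a⟩ = q at this
    obtain ⟨j', b⟩ := q
    obtain rfl : j = j' := this
    exact ⟨b, rfl⟩
  have hinv : ∀ j a, ∃ b, τ.symm ⟨j, a⟩ = ⟨j, b⟩ := fun j a => by
    have := hfst (τ.symm ⟨j, a⟩)
    rw [Equiv.apply_symm_apply] at this
    generalize τ.symm ⟨j, a⟩ = q at this
    obtain ⟨j', b⟩ := q
    obtain rfl : j' = j := this
    exact ⟨b, rfl⟩
  choose u hu using hto
  choose v hv using hinv
  let σ : ∀ j, Equiv.Perm (Fin (α j)) := fun j =>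
    { toFun := u j
      invFun := v j
      left_inv := fun a => by
        have := hv j (u j a)
        rw [← hu, Equiv.symm_apply_apply] at this
        simpa using this.symm
      right_inv := fun a => by
        have := hu j (v j a)
        rw [← hv, Equiv.apply_symm_apply] at this
        simpa using this.symm }
  have hblock : ∀ j a, ∃ f : ↥(AutGC (D j)), ∀ x,
      blockEquiv G e (φ x) ⟨j, a⟩ =
        (f : MulAut (Fin (m j) → G)) (blockEquiv G e x ⟨j, (σ j)⁻¹ a⟩) := by
    intro j a
    have hp : τ ⟨j, (σ j)⁻¹ a⟩ = ⟨j, a⟩ := by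
      rw [← Equiv.eq_symm_apply, hv]; rfl
    have := hτ ⟨j, (σ j)⁻¹ a⟩
    rw [hp] at this
    obtain ⟨f, hf, hf1, hf2⟩ := exists_blockMap e (fun p => D p.1) C hC hφ this
    exact ⟨⟨f, hf1, hf2⟩, hf⟩
  choose f hf using hblock
  refine ⟨fun j => ⟨f j, σ j⟩, MulEquiv.ext fun x => (blockEquiv G e).injective ?_⟩
  funext ⟨j, a⟩
  rw [hf]
  simp only [MulAut.congr, MulEquiv.coe_mk, Equiv.coe_fn_mk, MulEquiv.trans_apply,
    MulEquiv.symm_symm, MulEquiv.apply_symm_apply]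
  rfl

end WreathAction

theorem gcDecomposable_of_subsingleton {G : Type*} [Group G] [DecidableEq G] [Subsingleton G]
    {n : ℕ} (C : Subgroup (Fin n → G)) : GCDecomposable C :=
  ⟨1, 1, ⊤, ⊤, one_pos, one_pos, 1, 1,
    ⟨fun _ _ => Subsingleton.elim _ _, fun _ _ => ⟨trivial, trivial⟩, fun x y => by
      rw [Subsingleton.elim x y, hammingDist_self, hammingDist_self]⟩,
    ⟨fun _ _ => Subsingleton.elim _ _, fun _ _ => C.one_mem, fun x y => by
      rw [Subsingleton.elim x y, hammingDist_self, hammingDist_self]⟩,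
    fun _ => Subsingleton.elim _ _, fun _ => Subsingleton.elim _ _⟩


/-- If `D_1, …, D_k` are pairwise non-isomorphic indecomposable group
codes and `α_j ≥ 1`, then `Aut_GC(D_1^{α_1} ⊕ ⋯ ⊕ D_k^{α_k})` is isomorphic to the direct
product over `j` of the semidirect products `(Aut_GC(D_j))^{α_j} ⋊ S_{α_j}`. -/
theorem autGC_sum_powers_eq_prod_semidirect {G : Type*} [Group G] [Fintype G] [DecidableEq G]
    {k : ℕ} (m α : Fin k → ℕ) (hm : ∀ j, 0 < m j) (hα : ∀ j, 0 < α j)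
    (D : ∀ j, Subgroup (Fin (m j) → G))
    (hind : ∀ j, ¬ GCDecomposable (D j))
    (hnoniso : ∀ s t, s ≠ t → ¬ GroupCodeIso (D s) (D t)) :
    Nonempty (↥(AutGC (gcMultiSum (fun j => gcPow (D j) (α j)))) ≃*
      ∀ j, (Fin (α j) → ↥(AutGC (D j)))
        ⋊[permActionHom ↥(AutGC (D j)) (α j)] Equiv.Perm (Fin (α j))) := by
  rcases subsingleton_or_nontrivial G with hG | hG
  · have : IsEmpty (Fin k) := ⟨fun j => hind j (gcDecomposable_of_subsingleton _)⟩
    have : Subsingleton (MulAut (Fin (∑ j, ∑ _ : Fin (α j), m j) → G)) :=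
      ⟨fun φ ψ => MulEquiv.ext fun _ => Subsingleton.elim _ _⟩
    exact ⟨{ toFun := 1, invFun := 1, left_inv := fun _ => Subsingleton.elim _ _,
             right_inv := fun _ => Subsingleton.elim _ _,
             map_mul' := fun _ _ => Subsingleton.elim _ _ }⟩
  obtain ⟨e₁, he₁⟩ := exists_equiv_mem_gcMultiSum fun j => gcPow (D j) (α j)
  choose e₂ he₂ using fun j => exists_equiv_mem_gcMultiSum fun _ : Fin (α j) => D j
  let e : (Σ p : (Σ j, Fin (α j)), Fin (m p.1)) ≃ Fin (∑ j, ∑ _ : Fin (α j), m j) :=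
    ((Equiv.sigmaAssoc fun j (_ : Fin (α j)) => Fin (m j)).trans
      (Equiv.sigmaCongrRight e₂)).trans e₁
  have hC : ∀ x, x ∈ gcMultiSum (fun j => gcPow (D j) (α j)) ↔
      ∀ p : Σ j, Fin (α j), blockEquiv G e x p ∈ D p.1 := fun x => by
    rw [he₁, Sigma.forall]
    exact forall_congr' fun j => he₂ j _
  let F := ((MulAut.congr (blockEquiv G e).symm).toMonoidHom.comp (wreathAct D)).codRestrict _
    (symm_wreathAct_mem_autGC e _ hC)
  refine ⟨(MulEquiv.ofBijective F ⟨fun γ δ h => ?_, fun φ => ?_⟩).symm⟩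
  · exact wreathAct_injective hm ((MulAut.congr (blockEquiv G e).symm).injective
      (congrArg Subtype.val h))
  · obtain ⟨γ, hγ⟩ := exists_wreathAct_eq hm e _ hC hind hnoniso φ.2
    exact ⟨γ, Subtype.ext hγ⟩
end
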